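/- Let E and F be real inner product spaces, and let f : E × F → ℝ be differentiable, strongly convex with parameter μ > 0, with L-Lipschitz gradient (L ≥ μ). Let 𝒳 ⊆ E and 𝒴 ⊆ F be convex sets, let (X*, Y*) ∈ 𝒳 × 𝒴 minimize f over 𝒳 × 𝒴 with f* := f(X*, Y*). Suppose X_k ∈ 𝒳 minimizes X ↦ f(X, Y_k) over 𝒳 and Y_{k+1} ∈ 𝒴 minimizes Y ↦ f(X_k, Y) over 𝒴. Then f(X_k, Y_{k+1}) − f* ≤ (1 − μ/L) · (f(X_k, Y_k) − f*). -/

import Mathlib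

open scoped RealInnerProductSpace

/-- The quadratic upper bound (descent lemma) for a function with Lipschitz gradient. -/
theorem le_add_inner_add_sq_of_lipschitz_gradient
    {V : Type*} [NormedAddCommGroup V] [InnerProductSpace ℝ V] [CompleteSpace V]
    {f : V → ℝ} {g : V → V} (hdiff : ∀ z, HasGradientAt f (g z) z) {L : ℝ}
    (hlip : ∀ z z', ‖g z - g z'‖ ≤ L * ‖z - z'‖) (z d : V) :
    f (z + d) ≤ f z + ⟪g z, d⟫ + L / 2 * ‖d‖ ^ 2 := by
  let φ : ℝ → ℝ := fun s => f (z + s • d) - s * ⟪g z, d⟫ - L / 2 * ‖d‖ ^ 2 * s ^ 2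
  have hφ (s : ℝ) : HasDerivAt φ (⟪g (z + s • d), d⟫ - ⟪g z, d⟫ - L * ‖d‖ ^ 2 * s) s := by
    have hline : HasDerivAt (fun s : ℝ => z + s • d) d s := by
      simpa using ((hasDerivAt_id s).smul_const d).const_add z
    have hf : HasDerivAt (fun s : ℝ => f (z + s • d)) ⟪g (z + s • d), d⟫ s := by
      simpa [Function.comp_def] using
        (hdiff (z + s • d)).hasFDerivAt.comp_hasDerivAt s hline
    have hlin := (hasDerivAt_id s).mul_const ⟪g z, d⟫
    have hsq := (hasDerivAt_pow 2 s).const_mul (L / 2 * ‖d‖ ^ 2)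
    refine ((hf.sub hlin).sub hsq).congr_deriv ?_
    norm_num
    ring
  have hanti : AntitoneOn φ (Set.Icc 0 1) := by
    refine antitoneOn_of_deriv_nonpos (convex_Icc 0 1)
      (fun s _ => (hφ s).continuousAt.continuousWithinAt)
      (fun s _ => (hφ s).differentiableAt.differentiableWithinAt) fun s hs => ?_
    rw [interior_Icc] at hs
    rw [(hφ s).deriv, ← inner_sub_left]
    have hg : ‖g (z + s • d) - g z‖ ≤ L * (s * ‖d‖) := by
      simpa [norm_smul, abs_of_pos hs.1] using hlip (z + s • d) z
    have := real_inner_le_norm (g (z + s • d) - g z) d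
    nlinarith [mul_le_mul_of_nonneg_right hg (norm_nonneg d)]
  have h := hanti (Set.left_mem_Icc.2 zero_le_one) (Set.right_mem_Icc.2 zero_le_one) zero_le_one
  simp only [φ, zero_smul, one_smul, add_zero] at h
  linarith

/-- First-order optimality along a segment on which `f` is minimal at the left endpoint. -/
theorem inner_gradient_nonneg_of_isMinOn_segment
    {V : Type*} [NormedAddCommGroup V] [InnerProductSpace ℝ V] [CompleteSpace V]
    {f : V → ℝ} {g z d : V} (hf : HasGradientAt f g z)
    (hmin : IsMinOn f (segment ℝ z (z + d)) z) : 0 ≤ ⟪g, d⟫ := by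
  simpa using hmin.localize.hasFDerivWithinAt_nonneg hf.hasFDerivAt.hasFDerivWithinAt
    (mem_posTangentConeAt_of_segment_subset subset_rfl)

/-- **Half-step contraction of the functional residual** (Y-update step):
`f(X_k, Y_{k+1}) - f* ≤ (1 - μ/L) (f(X_k, Y_k) - f*)` for exact alternating
minimization of a `μ`-strongly convex function with `L`-Lipschitz gradient over convex sets. -/
theorem alternating_minimization_step_contraction_Y
    {E F : Type*} [NormedAddCommGroup E] [InnerProductSpace ℝ E] [CompleteSpace E]
    [NormedAddCommGroup F] [InnerProductSpace ℝ F] [CompleteSpace F]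
    (f : WithLp 2 (E × F) → ℝ) (g : WithLp 2 (E × F) → WithLp 2 (E × F))
    (hdiff : ∀ z, HasGradientAt f (g z) z)
    (μ L : ℝ) (hμ : 0 < μ) (hμL : μ ≤ L)
    (hsc : ∀ z z' : WithLp 2 (E × F),
      f z + ⟪g z, z' - z⟫ + μ / 2 * ‖z' - z‖ ^ 2 ≤ f z')
    (hlip : ∀ z z' : WithLp 2 (E × F), ‖g z - g z'‖ ≤ L * ‖z - z'‖)
    (𝒳 : Set E) (𝒴 : Set F) (hXconv : Convex ℝ 𝒳) (hYconv : Convex ℝ 𝒴)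
    (Xs : E) (Ys : F) (hXs : Xs ∈ 𝒳) (hYs : Ys ∈ 𝒴)
    (hmin : ∀ x ∈ 𝒳, ∀ y ∈ 𝒴,
      f ((WithLp.equiv 2 (E × F)).symm (Xs, Ys)) ≤ f ((WithLp.equiv 2 (E × F)).symm (x, y)))
    (Xk : E) (Yk : F) (Yk1 : F)
    (hXk : Xk ∈ 𝒳) (hYk : Yk ∈ 𝒴) (hYk1 : Yk1 ∈ 𝒴)
    (hXstep : ∀ x ∈ 𝒳,
      f ((WithLp.equiv 2 (E × F)).symm (Xk, Yk)) ≤ f ((WithLp.equiv 2 (E × F)).symm (x, Yk)))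
    (hYstep : ∀ y ∈ 𝒴,
      f ((WithLp.equiv 2 (E × F)).symm (Xk, Yk1)) ≤ f ((WithLp.equiv 2 (E × F)).symm (Xk, y))) :
    f ((WithLp.equiv 2 (E × F)).symm (Xk, Yk1)) - f ((WithLp.equiv 2 (E × F)).symm (Xs, Ys)) ≤
      (1 - μ / L) *
        (f ((WithLp.equiv 2 (E × F)).symm (Xk, Yk)) -
          f ((WithLp.equiv 2 (E × F)).symm (Xs, Ys))) := by
  let P (x : E) (y : F) : WithLp 2 (E × F) := (WithLp.equiv 2 (E × F)).symm (x, y)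
  have hL : 0 < L := hμ.trans_le hμL
  have ht0 : 0 ≤ μ / L := by positivity
  have ht1 : μ / L ≤ 1 := (div_le_one hL).2 hμL
  have hopt : 0 ≤ ⟪g (P Xk Yk), P (Xs - Xk) 0⟫ := by
    refine inner_gradient_nonneg_of_isMinOn_segment (hdiff _) ?_
    rw [segment_eq_image']
    rintro _ ⟨s, hs, rfl⟩
    have heq : P Xk Yk + s • (P Xk Yk + P (Xs - Xk) 0 - P Xk Yk) =
        P (Xk + s • (Xs - Xk)) Yk := by
      rw [add_sub_cancel_left]
      apply (WithLp.equiv 2 (E × F)).injective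
      simp [P]
    simp only [Set.mem_ofPred_eq, heq]
    exact hXstep _ (hXconv.add_smul_sub_mem hXk hXs hs)
  have hdesc : f (P Xk Yk1) ≤ f (P Xk Yk) + ⟪g (P Xk Yk), (μ / L) • P 0 (Ys - Yk)⟫ +
      L / 2 * ‖(μ / L) • P 0 (Ys - Yk)‖ ^ 2 := by
    refine le_trans ?_ (le_add_inner_add_sq_of_lipschitz_gradient hdiff hlip _ _)
    have heq : P Xk Yk + (μ / L) • P 0 (Ys - Yk) = P Xk (Yk + (μ / L) • (Ys - Yk)) := by
      apply (WithLp.equiv 2 (E × F)).injective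
      simp [P]
    rw [heq]
    exact hYstep _ (hYconv.add_smul_sub_mem hYk hYs ⟨ht0, ht1⟩)
  have hstrong := hsc (P Xk Yk) (P Xs Ys)
  have hsplit : P Xs Ys - P Xk Yk = P (Xs - Xk) 0 + P 0 (Ys - Yk) := by
    apply (WithLp.equiv 2 (E × F)).injective
    simp [P]
  have hnorm : ‖P 0 (Ys - Yk)‖ ^ 2 ≤ ‖P Xs Ys - P Xk Yk‖ ^ 2 := by
    rw [hsplit, WithLp.prod_norm_sq_eq_of_L2, WithLp.prod_norm_sq_eq_of_L2]
    simp [P]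
  have hinner : ⟪g (P Xk Yk), P Xs Ys - P Xk Yk⟫ =
      ⟪g (P Xk Yk), P (Xs - Xk) 0⟫ + ⟪g (P Xk Yk), P 0 (Ys - Yk)⟫ := by
    rw [hsplit, inner_add_right]
  have hlower : ⟪g (P Xk Yk), P 0 (Ys - Yk)⟫ + μ / 2 * ‖P 0 (Ys - Yk)‖ ^ 2 ≤
      f (P Xs Ys) - f (P Xk Yk) := by
    have := mul_le_mul_of_nonneg_left hnorm (by positivity : 0 ≤ μ / 2)
    linarith
  have hscale : L / 2 * (μ / L * ‖P 0 (Ys - Yk)‖) ^ 2 =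
      μ / L * (μ / 2 * ‖P 0 (Ys - Yk)‖ ^ 2) := by
    field_simp
  rw [real_inner_smul_right, norm_smul, Real.norm_of_nonneg ht0, hscale] at hdesc
  change f (P Xk Yk1) - f (P Xs Ys) ≤ (1 - μ / L) * (f (P Xk Yk) - f (P Xs Ys))
  linarith [mul_le_mul_of_nonneg_left hlower ht0]
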